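/- For every q ∈ [1,2], every χ ≥ 0, and every random variable B with E[B²] < ∞ independent of Z ~ N(0,1), the function σ ↦ R_q(χ,σ) = E[(η_q(B/σ + Z; χ) − B/σ)²] is nonincreasing on (0,∞). -/

import Mathlib

open MeasureTheory ProbabilityTheory Real Filter Set

noncomputable section

/-- The standard Gaussian measure on `ℝ`. -/
def stdGaussian : Measure ℝ := gaussianReal 0 1

/-- `IsProx q χ u v` : `v` minimizes `z ↦ (1/2)(u−z)² + χ|z|^q`,
i.e. `v = η_q(u;χ)` is the proximal operator of `χ|·|^q` at `u`. -/
def IsProx (q χ u v : ℝ) : Prop :=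
  ∀ z : ℝ, (1/2) * (u - v)^2 + χ * |v| ^ q ≤ (1/2) * (u - z)^2 + χ * |z| ^ q

/-- First-order optimality condition for the proximal operator: `u - v` is a subgradient
of `χ|·|^q` at `v`. -/
lemma IsProx.sub_mul_sub_le {q χ u v : ℝ} (hq : 1 ≤ q) (hχ : 0 ≤ χ) (h : IsProx q χ u v)
    (z : ℝ) : (u - v) * (z - v) ≤ χ * |z| ^ q - χ * |v| ^ q := by
  have key : ∀ t : ℝ, 0 < t → t ≤ 1 →
      (u - v) * (z - v) - (χ * |z| ^ q - χ * |v| ^ q) ≤ 1 / 2 * t * (z - v) ^ 2 := by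
    intro t ht0 ht1
    have hmin := h ((1 - t) * v + t * z)
    have habs : |(1 - t) * v + t * z| ≤ (1 - t) * |v| + t * |z| := by
      refine (abs_add_le _ _).trans ?_
      rw [abs_mul, abs_mul, abs_of_nonneg ht0.le, abs_of_nonneg (by linarith : 0 ≤ 1 - t)]
    have hconv : |(1 - t) * v + t * z| ^ q ≤ (1 - t) * |v| ^ q + t * |z| ^ q :=
      (rpow_le_rpow (abs_nonneg _) habs (by linarith)).trans <| by
        simpa using (convexOn_rpow hq).2 (mem_Ici.2 (abs_nonneg v)) (mem_Ici.2 (abs_nonneg z))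
          (by linarith : 0 ≤ 1 - t) ht0.le (by ring)
    have hconv' := mul_le_mul_of_nonneg_left hconv hχ
    refine le_of_mul_le_mul_left ?_ ht0
    nlinarith
  set A := (u - v) * (z - v) - (χ * |z| ^ q - χ * |v| ^ q) with hA
  by_contra! hlt
  have hApos : 0 < A := by rw [hA]; linarith
  have hden : 0 < A + (z - v) ^ 2 := by positivity
  have := key (A / (A + (z - v) ^ 2)) (by positivity)
    ((div_le_one hden).2 (by nlinarith [sq_nonneg (z - v)]))
  have h2 : A * (A + (z - v) ^ 2) ≤ 1 / 2 * A * (z - v) ^ 2 := by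
    calc A * (A + (z - v) ^ 2)
        ≤ 1 / 2 * (A / (A + (z - v) ^ 2)) * (z - v) ^ 2 * (A + (z - v) ^ 2) := by gcongr
      _ = 1 / 2 * A * (z - v) ^ 2 := by field_simp
  nlinarith [mul_nonneg hApos.le (sq_nonneg (z - v))]

lemma IsProx.sq_residual_sub_le {q χ u₁ v₁ u₂ v₂ : ℝ} (hq : 1 ≤ q) (hχ : 0 ≤ χ)
    (h₁ : IsProx q χ u₁ v₁) (h₂ : IsProx q χ u₂ v₂) :
    ((u₁ - v₁) - (u₂ - v₂)) ^ 2 ≤ ((u₁ - v₁) - (u₂ - v₂)) * (u₁ - u₂) := by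
  nlinarith [h₁.sub_mul_sub_le hq hχ v₂, h₂.sub_mul_sub_le hq hχ v₁]

lemma IsProx.unique {q χ u v₁ v₂ : ℝ} (hq : 1 ≤ q) (hχ : 0 ≤ χ)
    (h₁ : IsProx q χ u v₁) (h₂ : IsProx q χ u v₂) : v₁ = v₂ := by
  have := h₁.sq_residual_sub_le hq hχ h₂
  nlinarith [sq_nonneg (v₁ - v₂)]

lemma IsProx.neg {q χ u v : ℝ} (h : IsProx q χ u v) : IsProx q χ (-u) (-v) := by
  intro z
  have := h (-z)
  rw [abs_neg] at this ⊢
  convert this using 2 <;> ring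

lemma IsProx.residual_eq {q χ u v : ℝ} (h : IsProx q χ u v) (hv : 0 < v) :
    u - v = χ * (q * v ^ (q - 1)) := by
  have hmin : IsLocalMin (fun z : ℝ => 1 / 2 * (u - z) ^ 2 + χ * z ^ q) v := by
    filter_upwards [lt_mem_nhds hv] with z hz
    simpa [abs_of_pos hv, abs_of_pos hz] using h z
  have hd : HasDerivAt (fun z : ℝ => 1 / 2 * (u - z) ^ 2 + χ * z ^ q)
      (1 / 2 * (2 * (u - v) * (-1)) + χ * (q * v ^ (q - 1))) v := by
    have h1 := (((hasDerivAt_id v).const_sub u).pow 2).const_mul (1 / 2 : ℝ)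
    have h2 := (hasDerivAt_rpow_const (p := q) (Or.inl hv.ne')).const_mul χ
    refine (h1.add h2).congr_deriv ?_
    norm_num
  linarith [hmin.hasDerivAt_eq_zero hd]

lemma IsProx.residual_le {q χ u v : ℝ} (hq : 1 ≤ q) (hχ : 0 ≤ χ) (h : IsProx q χ u v)
    (hv : 0 ≤ v) : u - v ≤ χ * (q * v ^ (q - 1)) := by
  rcases hv.eq_or_lt with rfl | hv
  · have hz : ∀ z : ℝ, 0 < z → u ≤ χ * z ^ (q - 1) := by
      intro z hz
      have := h.sub_mul_sub_le hq hχ z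
      rw [abs_zero, zero_rpow (by linarith), abs_of_pos hz] at this
      refine le_of_mul_le_mul_right ?_ hz
      rw [mul_assoc, ← rpow_add_one hz.ne']
      simpa using this
    rcases hq.eq_or_lt with rfl | hq
    · simpa using hz 1 one_pos
    · have hlim : Tendsto (fun z : ℝ => χ * z ^ (q - 1)) (nhdsWithin 0 (Ioi 0))
          (nhds (χ * 0 ^ (q - 1))) :=
        ((continuousAt_rpow_const 0 (q - 1) (Or.inr (by linarith))).tendsto.mono_left
          nhdsWithin_le_nhds).const_mul χ
      have := ge_of_tendsto hlim (eventually_mem_nhdsWithin.mono hz)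
      rw [zero_rpow (by linarith)] at this ⊢
      simpa using this
  · exact (h.residual_eq hv).le

section Residual

variable {q χ : ℝ} {p : ℝ → ℝ}

lemma residual_neg (hq : 1 ≤ q) (hχ : 0 ≤ χ) (hp : ∀ u, IsProx q χ u (p u)) (u : ℝ) :
    -u - p (-u) = -(u - p u) := by
  rw [(hp (-u)).unique hq hχ (hp u).neg]
  ring

lemma monotone_residual (hq : 1 ≤ q) (hχ : 0 ≤ χ) (hp : ∀ u, IsProx q χ u (p u)) :
    Monotone fun u => u - p u := by
  intro a b hab
  have := (hp b).sq_residual_sub_le hq hχ (hp a)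
  dsimp only
  by_contra! hlt
  nlinarith [mul_nonneg (sub_nonneg.2 hlt.le) (sub_nonneg.2 hab)]

lemma monotone_of_isProx (hq : 1 ≤ q) (hχ : 0 ≤ χ) (hp : ∀ u, IsProx q χ u (p u)) :
    Monotone p := by
  intro a b hab
  have := (hp b).sq_residual_sub_le hq hχ (hp a)
  by_contra! hlt
  nlinarith [mul_nonneg (sub_nonneg.2 hlt.le) (sub_nonneg.2 hab)]

lemma isProx_zero_right (hq : 1 ≤ q) (hχ : 0 ≤ χ) : IsProx q χ 0 0 := by
  intro z
  rw [abs_zero, zero_rpow (by linarith)]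
  nlinarith [mul_nonneg hχ (rpow_nonneg (abs_nonneg z) q), sq_nonneg z]

lemma abs_residual_le (hq : 1 ≤ q) (hχ : 0 ≤ χ) (hp : ∀ u, IsProx q χ u (p u)) (u : ℝ) :
    |u - p u| ≤ |u| := by
  have := (hp u).sq_residual_sub_le hq hχ (isProx_zero_right hq hχ)
  simp only [sub_zero] at this
  rcases (abs_nonneg (u - p u)).eq_or_lt with h0 | h0
  · rw [← h0]; exact abs_nonneg u
  · refine le_of_mul_le_mul_left ?_ h0
    rw [← abs_mul (u - p u) u, abs_mul_abs_self, ← pow_two]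
    exact this.trans (le_abs_self _)

/-- On the half-line, the residual solves `h = χ q (u - h)^(q-1)` where the prox is positive,
and therefore inherits concavity from `v ↦ v^(q-1)`. -/
lemma concaveOn_residual (hq : 1 ≤ q) (hq2 : q ≤ 2) (hχ : 0 ≤ χ)
    (hp : ∀ u, IsProx q χ u (p u)) : ConcaveOn ℝ (Ici 0) fun u => u - p u := by
  have hp0 : p 0 = 0 := (hp 0).unique hq hχ (isProx_zero_right hq hχ)
  have hpos : ∀ u, 0 ≤ u → 0 ≤ p u := fun u hu => hp0 ▸ monotone_of_isProx hq hχ hp hu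
  refine ⟨convex_Ici 0, fun x hx y hy a b ha hb hab => ?_⟩
  simp only [smul_eq_mul, mem_Ici] at hx hy ⊢
  by_contra! hlt
  have hx' := hpos x hx
  have hy' := hpos y hy
  have hmix : 0 ≤ a * p x + b * p y := by positivity
  set u := a * x + b * y
  have hv : a * p x + b * p y < p u := by linarith
  have heq := (hp u).residual_eq (hmix.trans_lt hv)
  have hconc := (concaveOn_rpow (by linarith : 0 ≤ q - 1) (by linarith)).2
    (mem_Ici.2 hx') (mem_Ici.2 hy') ha hb hab
  simp only [smul_eq_mul] at hconc
  have hmono : (a * p x + b * p y) ^ (q - 1) ≤ p u ^ (q - 1) :=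
    rpow_le_rpow hmix hv.le (by linarith)
  have h1 := mul_le_mul_of_nonneg_left ((hp x).residual_le hq hχ hx') ha
  have h2 := mul_le_mul_of_nonneg_left ((hp y).residual_le hq hχ hy') hb
  have h3 := mul_le_mul_of_nonneg_left (hconc.trans hmono) (by positivity : 0 ≤ χ * q)
  nlinarith

end Residual

/-- Increments of a concave function on the half-line decrease. -/
lemma ConcaveOn.add_sub_le_of_Ici {h : ℝ → ℝ} (hc : ConcaveOn ℝ (Ici 0) h) {x d s : ℝ}
    (hx : 0 ≤ x) (hd : 0 ≤ d) (hs : 0 ≤ s) : h (x + s + d) - h (x + s) ≤ h (x + d) - h x := by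
  rcases (add_nonneg hd hs).eq_or_lt with h0 | h0
  · obtain rfl : d = 0 := by linarith
    simp
  · have hy : (0 : ℝ) ≤ x + s + d := by positivity
    have hsum : s / (d + s) + d / (d + s) = 1 := by field_simp; ring
    have h1 := hc.2 (mem_Ici.2 hx) (mem_Ici.2 hy) (by positivity : 0 ≤ s / (d + s))
      (by positivity : 0 ≤ d / (d + s)) hsum
    have h2 := hc.2 (mem_Ici.2 hx) (mem_Ici.2 hy) (by positivity : 0 ≤ d / (d + s))
      (by positivity : 0 ≤ s / (d + s)) (by rw [add_comm, hsum])
    simp only [smul_eq_mul] at h1 h2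
    rw [show s / (d + s) * x + d / (d + s) * (x + s + d) = x + d by field_simp; ring] at h1
    rw [show d / (d + s) * x + s / (d + s) * (x + s + d) = x + s by field_simp; ring] at h2
    have e1 : s / (d + s) = 1 - d / (d + s) := by linarith
    rw [e1] at h1 h2
    linarith

/-- For `h` odd and concave on the half-line, symmetric increments decrease away from the
origin. -/
lemma symmetric_increment_le {h : ℝ → ℝ} (hodd : ∀ u, h (-u) = -h u)
    (hc : ConcaveOn ℝ (Ici 0) h) {a b z : ℝ} (ha : 0 ≤ a) (hab : a ≤ b) (hz : 0 ≤ z) :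
    h (b + z) - h (b - z) ≤ h (a + z) - h (a - z) := by
  have h0 : h 0 = 0 := by linarith [neg_zero (G := ℝ) ▸ hodd 0]
  rcases le_total z a with hza | haz
  · have := hc.add_sub_le_of_Ici (sub_nonneg.2 hza) (sub_nonneg.2 hab)
      (by positivity : 0 ≤ 2 * z)
    rw [show a - z + 2 * z + (b - a) = b + z by ring, show a - z + 2 * z = a + z by ring,
      show a - z + (b - a) = b - z by ring] at this
    linarith
  rw [show a - z = -(z - a) by ring, hodd]
  rcases le_total b z with hbz | hzb
  · have := hc.add_sub_le_of_Ici (sub_nonneg.2 hbz) (sub_nonneg.2 hab)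
      (add_nonneg ha (ha.trans hab))
    rw [show z - b + (a + b) + (b - a) = b + z by ring, show z - b + (a + b) = a + z by ring,
      show z - b + (b - a) = z - a by ring] at this
    rw [show b - z = -(z - b) by ring, hodd]
    linarith
  · have h1 := hc.add_sub_le_of_Ici le_rfl (sub_nonneg.2 hab) (add_nonneg ha hz)
    have h2 := hc.add_sub_le_of_Ici le_rfl (sub_nonneg.2 hzb) (sub_nonneg.2 haz)
    rw [show 0 + (a + z) + (b - a) = b + z by ring, zero_add, zero_add, h0] at h1
    rw [show 0 + (z - a) + (b - z) = b - a by ring, zero_add, zero_add, h0] at h2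
    linarith

instance : IsProbabilityMeasure stdGaussian := by
  unfold _root_.stdGaussian
  infer_instance

lemma integral_stdGaussian_neg (f : ℝ → ℝ) :
    ∫ z, f (-z) ∂stdGaussian = ∫ z, f z ∂stdGaussian := by
  have hmap : (_root_.stdGaussian).map (fun x => -x) = _root_.stdGaussian := by
    simpa [_root_.stdGaussian] using gaussianReal_map_neg (μ := 0) (v := 1)
  conv_rhs => rw [← hmap]
  exact ((MeasurableEquiv.neg ℝ).measurableEmbedding.integral_map f).symm

lemma integrable_sq_stdGaussian : Integrable (fun z : ℝ => z ^ 2) stdGaussian :=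
  (memLp_id_gaussianReal (μ := 0) (v := 1) 2).integrable_sq

lemma integrable_stdGaussian_of_quadratic_growth {f : ℝ → ℝ} (hf : Measurable f) {A B : ℝ}
    (hbd : ∀ z, |f z| ≤ A + B * z ^ 2) : Integrable f stdGaussian :=
  ((integrable_const A).add (integrable_sq_stdGaussian.const_mul B)).mono'
    hf.aestronglyMeasurable (ae_of_all _ hbd)

lemma integrable_stdGaussian_iff {f : ℝ → ℝ} :
    Integrable f stdGaussian ↔ Integrable fun z => gaussianPDFReal 0 1 z * f z := by
  rw [_root_.stdGaussian, gaussianReal_of_var_ne_zero _ one_ne_zero,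
    integrable_withDensity_iff_integrable_smul' (measurable_gaussianPDF _ _)
      (ae_of_all _ fun _ => gaussianPDF_lt_top)]
  simp [toReal_gaussianPDF]

lemma gaussianPDFReal_zero_one_le {x y : ℝ} (h : |x| ≤ |y|) :
    gaussianPDFReal 0 1 y ≤ gaussianPDFReal 0 1 x := by
  have := sq_le_sq.2 h
  simp only [gaussianPDFReal, sub_zero]
  gcongr

/-- One-dimensional Anderson inequality: the mean of a function increasing in `|·|` increases
as the Gaussian moves away from the origin. -/
lemma integral_stdGaussian_shift_mono {f : ℝ → ℝ} (hf : ∀ x y, |x| ≤ |y| → f x ≤ f y)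
    (hint : ∀ c, Integrable (fun z => f (c + z)) stdGaussian) {a b : ℝ} (ha : 0 ≤ a)
    (hab : a ≤ b) :
    ∫ z, f (a + z) ∂stdGaussian ≤ ∫ z, f (b + z) ∂stdGaussian := by
  set φ := gaussianPDFReal 0 1 with hφ
  have hφ_even : ∀ x, φ (-x) = φ x := fun x =>
    le_antisymm (gaussianPDFReal_zero_one_le (abs_neg x).ge)
      (gaussianPDFReal_zero_one_le (abs_neg x).le)
  set m := (a + b) / 2 with hm
  set d := (b - a) / 2 with hd
  have hm0 : 0 ≤ m := by rw [hm]; linarith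
  have hd0 : 0 ≤ d := by rw [hd]; linarith
  have hint' : ∀ c, Integrable fun z => φ z * f (c + z) := fun c =>
    integrable_stdGaussian_iff.1 (hint c)
  have hexp : ∀ c, ∫ z, f (c + z) ∂stdGaussian = ∫ z, φ z * f (c + z) := fun c => by
    simp [_root_.stdGaussian, integral_gaussianReal_eq_integral_smul, hφ]
  have hia : Integrable fun v => φ (v + d) * f (m + v) := by
    refine ((hint' a).comp_add_right d).congr (ae_of_all _ fun v => ?_)
    dsimp only
    rw [hm, hd]; ring_nf
  have hib : Integrable fun v => φ (v - d) * f (m + v) := by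
    refine ((hint' b).comp_sub_right d).congr (ae_of_all _ fun v => ?_)
    dsimp only
    rw [hm, hd]; ring_nf
  have hia' : Integrable fun v => φ (v - d) * f (m - v) := by
    convert hia.comp_neg using 3 with v
    · rw [← hφ_even]; ring_nf
    · rw [sub_eq_add_neg]
  have hib' : Integrable fun v => φ (v + d) * f (m - v) := by
    convert hib.comp_neg using 3 with v
    · rw [← hφ_even]; ring_nf
    · rw [sub_eq_add_neg]
  have ea : ∫ z, f (a + z) ∂stdGaussian = ∫ v, φ (v + d) * f (m + v) := by
    rw [hexp, ← integral_add_right_eq_self _ d]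
    congr 1 with v
    rw [hm, hd]; ring_nf
  have eb : ∫ z, f (b + z) ∂stdGaussian = ∫ v, φ (v - d) * f (m + v) := by
    rw [hexp, ← integral_sub_right_eq_self _ d]
    congr 1 with v
    rw [hm, hd]; ring_nf
  have ea' : ∫ v, φ (v + d) * f (m + v) = ∫ v, φ (v - d) * f (m - v) := by
    rw [← integral_neg_eq_self]
    congr 1 with v
    rw [← hφ_even]; ring_nf
  have eb' : ∫ v, φ (v - d) * f (m + v) = ∫ v, φ (v + d) * f (m - v) := by
    rw [← integral_neg_eq_self]
    congr 1 with v
    rw [← hφ_even]; ring_nf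
  have key : ∫ v, (φ (v + d) * f (m + v) + φ (v - d) * f (m - v))
      ≤ ∫ v, (φ (v - d) * f (m + v) + φ (v + d) * f (m - v)) := by
    refine integral_mono (hia.add hia') (hib.add hib') fun v => ?_
    dsimp only
    rcases le_total 0 v with hv | hv
    · have h1 : φ (v + d) ≤ φ (v - d) :=
        gaussianPDFReal_zero_one_le (sq_le_sq.1 (by nlinarith))
      have h2 : f (m - v) ≤ f (m + v) := hf _ _ (sq_le_sq.1 (by nlinarith))
      nlinarith [mul_nonneg (sub_nonneg.2 h1) (sub_nonneg.2 h2)]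
    · have h1 : φ (v - d) ≤ φ (v + d) :=
        gaussianPDFReal_zero_one_le (sq_le_sq.1 (by nlinarith))
      have h2 : f (m + v) ≤ f (m - v) := hf _ _ (sq_le_sq.1 (by nlinarith))
      nlinarith [mul_nonneg (sub_nonneg.2 h1) (sub_nonneg.2 h2)]
  rw [integral_add hia hia', integral_add hib hib', ← ea', ← eb'] at key
  rw [ea, eb]
  linarith

section Risk

variable {h : ℝ → ℝ}

lemma sq_shift_le (hle : ∀ u, |h u| ≤ |u|) (c z : ℝ) :
    h (c + z) ^ 2 ≤ 2 * c ^ 2 + 2 * z ^ 2 := by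
  nlinarith [sq_le_sq.2 (hle (c + z)), sq_nonneg (c - z)]

lemma integrable_shift_sq (hmeas : Measurable h) (hle : ∀ u, |h u| ≤ |u|) (c : ℝ) :
    Integrable (fun z => h (c + z) ^ 2) stdGaussian :=
  integrable_stdGaussian_of_quadratic_growth (by fun_prop) fun z => by
    rw [abs_of_nonneg (sq_nonneg _)]
    exact sq_shift_le hle c z

lemma integrable_mul_shift (hmeas : Measurable h) (hle : ∀ u, |h u| ≤ |u|) (c : ℝ) :
    Integrable (fun z => z * h (c + z)) stdGaussian :=
  integrable_stdGaussian_of_quadratic_growth (A := 2 * c ^ 2) (B := 3) (by fun_prop) fun z => by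
    have := sq_shift_le hle c z
    rw [abs_le]
    constructor <;>
      nlinarith [sq_nonneg (z + h (c + z)), sq_nonneg (z - h (c + z)), sq_nonneg z, sq_nonneg c,
        sq_nonneg (h (c + z))]

lemma two_mul_integral_mul_shift (hmeas : Measurable h) (hle : ∀ u, |h u| ≤ |u|) (c : ℝ) :
    Integrable (fun z => z * (h (c + z) - h (c - z))) stdGaussian ∧
      2 * ∫ z, z * h (c + z) ∂stdGaussian = ∫ z, z * (h (c + z) - h (c - z)) ∂stdGaussian := by
  have hi := integrable_mul_shift hmeas hle c
  have hi' : Integrable (fun z => -z * h (c + -z)) stdGaussian :=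
    integrable_stdGaussian_of_quadratic_growth (A := 2 * c ^ 2) (B := 3) (by fun_prop)
      fun z => by
        have := sq_shift_le hle c (-z)
        rw [abs_le]
        constructor <;>
          nlinarith [sq_nonneg (z + h (c + -z)), sq_nonneg (z - h (c + -z)), sq_nonneg z,
            sq_nonneg c, sq_nonneg (h (c + -z))]
  have hsum : (fun z => z * (h (c + z) - h (c - z)))
      = fun z => z * h (c + z) + -z * h (c + -z) := by
    ext z
    rw [← sub_eq_add_neg]
    ring
  rw [hsum]
  refine ⟨hi.add hi', ?_⟩
  rw [integral_add hi hi', integral_stdGaussian_neg fun z => z * h (c + z)]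
  ring

lemma integrable_risk (hmeas : Measurable h) (hle : ∀ u, |h u| ≤ |u|) (c : ℝ) :
    Integrable (fun z => (z - h (c + z)) ^ 2) stdGaussian :=
  integrable_stdGaussian_of_quadratic_growth (A := 4 * c ^ 2) (B := 6) (by fun_prop) fun z => by
    rw [abs_of_nonneg (sq_nonneg _)]
    nlinarith [sq_shift_le hle c z, sq_nonneg (z + h (c + z))]

lemma integral_risk_eq (hmeas : Measurable h) (hle : ∀ u, |h u| ≤ |u|) (c : ℝ) :
    ∫ z, (z - h (c + z)) ^ 2 ∂stdGaussian = ∫ z, z ^ 2 ∂stdGaussian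
      - ∫ z, z * (h (c + z) - h (c - z)) ∂stdGaussian + ∫ z, h (c + z) ^ 2 ∂stdGaussian := by
  have hi := integrable_mul_shift hmeas hle c
  have hsplit : (fun z => (z - h (c + z)) ^ 2)
      = fun z => z ^ 2 - 2 * (z * h (c + z)) + h (c + z) ^ 2 := by
    ext z
    ring
  have hadd := integral_add (integrable_sq_stdGaussian.sub (hi.const_mul 2))
    (integrable_shift_sq hmeas hle c)
  simp only [Pi.sub_apply] at hadd
  rw [hsplit, hadd, integral_sub integrable_sq_stdGaussian (hi.const_mul 2),
    integral_const_mul, (two_mul_integral_mul_shift hmeas hle c).2]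

lemma integral_risk_le (hmeas : Measurable h) (hle : ∀ u, |h u| ≤ |u|) (c : ℝ) :
    ∫ z, (z - h (c + z)) ^ 2 ∂stdGaussian
      ≤ 4 * c ^ 2 + 6 * ∫ z, z ^ 2 ∂stdGaussian := by
  have hq := integrable_sq_stdGaussian.const_mul 6
  calc ∫ z, (z - h (c + z)) ^ 2 ∂stdGaussian
      ≤ ∫ z, (4 * c ^ 2 + 6 * z ^ 2) ∂stdGaussian := by
        refine integral_mono (integrable_risk hmeas hle c) ((integrable_const _).add hq)
          fun z => ?_
        dsimp only
        nlinarith [sq_shift_le hle c z, sq_nonneg (z + h (c + z))]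
    _ = 4 * c ^ 2 + 6 * ∫ z, z ^ 2 ∂stdGaussian := by
        rw [integral_add (integrable_const _) hq]
        simp [integral_const_mul]

lemma integral_risk_neg (hodd : ∀ u, h (-u) = -h u) (c : ℝ) :
    ∫ z, (z - h (-c + z)) ^ 2 ∂stdGaussian = ∫ z, (z - h (c + z)) ^ 2 ∂stdGaussian := by
  rw [← integral_stdGaussian_neg]
  congr 1 with z
  rw [← neg_add, hodd]
  ring

/-- The Gaussian risk is nondecreasing in the absolute value of the location parameter. -/
lemma integral_risk_mono (hodd : ∀ u, h (-u) = -h u) (hmono : Monotone h)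
    (hle : ∀ u, |h u| ≤ |u|) (hconc : ConcaveOn ℝ (Ici 0) h) {a b : ℝ} (hab : |a| ≤ |b|) :
    ∫ z, (z - h (a + z)) ^ 2 ∂stdGaussian ≤ ∫ z, (z - h (b + z)) ^ 2 ∂stdGaussian := by
  have hmeas := hmono.measurable
  have habs : ∀ c, ∫ z, (z - h (c + z)) ^ 2 ∂stdGaussian
      = ∫ z, (z - h (|c| + z)) ^ 2 ∂stdGaussian := by
    intro c
    rcases abs_choice c with hc | hc <;> rw [hc]
    rw [integral_risk_neg hodd]
  rw [habs a, habs b, integral_risk_eq hmeas hle, integral_risk_eq hmeas hle]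
  have hcross : ∫ z, z * (h (|b| + z) - h (|b| - z)) ∂stdGaussian
      ≤ ∫ z, z * (h (|a| + z) - h (|a| - z)) ∂stdGaussian := by
    refine integral_mono (two_mul_integral_mul_shift hmeas hle _).1
      (two_mul_integral_mul_shift hmeas hle _).1 fun z => ?_
    dsimp only
    rcases le_total 0 z with hz | hz
    · exact mul_le_mul_of_nonneg_left
        (symmetric_increment_le hodd hconc (abs_nonneg a) hab hz) hz
    · have := symmetric_increment_le hodd hconc (abs_nonneg a) hab (neg_nonneg.2 hz)
      rw [sub_neg_eq_add, sub_neg_eq_add, ← sub_eq_add_neg, ← sub_eq_add_neg] at this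
      exact mul_le_mul_of_nonpos_left (by linarith) hz
  have h_abs : ∀ x, |h x| = h |x| := by
    have h0 : h 0 = 0 := by linarith [neg_zero (G := ℝ) ▸ hodd 0]
    intro x
    rcases le_total 0 x with hx | hx
    · rw [abs_of_nonneg hx, abs_of_nonneg (h0 ▸ hmono hx)]
    · rw [abs_of_nonpos hx, abs_of_nonpos (h0 ▸ hmono hx), hodd]
  have hsq := integral_stdGaussian_shift_mono (f := fun x => h x ^ 2)
    (fun x y hxy => sq_le_sq.2 (by rw [h_abs, h_abs]; exact hmono hxy))
    (integrable_shift_sq hmeas hle) (abs_nonneg a) hab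
  linarith

end Risk

/-- For every `q ∈ [1,2]`, `χ ≥ 0`, and random variable `B` (law `μB`) with `E[B²] < ∞`
independent of `Z ~ N(0,1)`, the map `σ ↦ R_q(χ,σ) = E[(η_q(B/σ+Z;χ) − B/σ)²]` is
nonincreasing on `(0,∞)`. -/
theorem R_q_antitone_in_sigma
    (q χ : ℝ) (hq1 : 1 ≤ q) (hq2 : q ≤ 2) (hχ : 0 ≤ χ)
    (μB : Measure ℝ) [IsProbabilityMeasure μB]
    (hB : Integrable (fun b => b^2) μB)
    (η : ℝ → ℝ → ℝ) (hη : ∀ u c, 0 ≤ c → IsProx q c u (η u c)) :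
    AntitoneOn (fun σ => ∫ b, (∫ z, (η (b/σ + z) χ - b/σ)^2 ∂stdGaussian) ∂μB)
      (Ioi (0:ℝ)) := by
  set h : ℝ → ℝ := fun u => u - η u χ with hh
  have hp : ∀ u, IsProx q χ u (η u χ) := fun u => hη u χ hχ
  have hodd : ∀ u, h (-u) = -h u := residual_neg hq1 hχ hp
  have hmono : Monotone h := monotone_residual hq1 hχ hp
  have hle : ∀ u, |h u| ≤ |u| := abs_residual_le hq1 hχ hp
  have hconc : ConcaveOn ℝ (Ici 0) h := concaveOn_residual hq1 hq2 hχ hp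
  have hmeas : Measurable h := hmono.measurable
  have hrisk : ∀ β z : ℝ, (η (β + z) χ - β) ^ 2 = (z - h (β + z)) ^ 2 := fun β z => by
    rw [hh]; ring
  intro s hs t ht hst
  simp only [hrisk]
  refine integral_mono_of_nonneg (ae_of_all _ fun b => integral_nonneg fun z => sq_nonneg _)
    ?_ (ae_of_all _ fun b => integral_risk_mono hodd hmono hle hconc ?_)
  · have hsm : StronglyMeasurable fun b => ∫ z, (z - h (b / s + z)) ^ 2 ∂stdGaussian := by
      refine StronglyMeasurable.integral_prod_right
        (f := fun b z => (z - h (b / s + z)) ^ 2) (Measurable.stronglyMeasurable ?_)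
      unfold Function.uncurry
      fun_prop
    refine ((hB.const_mul (4 / s ^ 2)).add
      (integrable_const (6 * ∫ z, z ^ 2 ∂stdGaussian))).mono' hsm.aestronglyMeasurable
      (ae_of_all _ fun b => ?_)
    rw [norm_of_nonneg (integral_nonneg fun z => sq_nonneg _)]
    refine (integral_risk_le hmeas hle (b / s)).trans_eq ?_
    simp only [Pi.add_apply]
    ring
  · have hs' : (0 : ℝ) < s := hs
    have ht' : (0 : ℝ) < t := ht
    rw [abs_div, abs_div, abs_of_pos hs', abs_of_pos ht']
    gcongr
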